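/- arXiv:1710.02852 — 5 statements merged into one kernel-verified Lean document; each statement's English description precedes it below -/
import Mathlib

section
/- Assume each f_i is additionally differentiable, and suppose W* ∈ ∏_{i∈N} 𝒲_i is feasible (G_ik(W*_i, W*_k) = 0 for all (i,k) ∈ Ê). Let (Wⁿ, pⁿ) be given and let (W^{n+1}, p^{n+1}) be produced by one scheduled-asynchronous update. Then Σ_{i∈N} ( f_i(W_i^{n+1}) − f_i(W*_i) ) ≤ − Σ_{(i,k)∈Ê} ⟨p_ik^{n+1}, r_ik^{n+1}⟩ + Σ_{(i,k)∈Ê} ρ_ik ⟨ D_ki(W_kⁿ − W_k^{n+1}), D_ik(W*_i − W_i^{n+1}) ⟩, where r_ik^{n+1} := G_ik(W_i^{n+1}, W_k^{n+1}). -/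
open Finset RealInnerProductSpace

/-- The coupling constraint map `G_ik(W_i, W_k) = D_ik(W_i) + D_ki(W_k)` for a directed
edge `e = (i,k)`, evaluated at the profile `W`. -/
noncomputable def Gmap {ι : Type*} {m : ℕ} {H : ι → Type*}
    [∀ i, NormedAddCommGroup (H i)] [∀ i, InnerProductSpace ℝ (H i)]
    (Dt : ∀ e : ι × ι, H e.1 →ₗ[ℝ] EuclideanSpace ℝ (Fin m))
    (Dh : ∀ e : ι × ι, H e.2 →ₗ[ℝ] EuclideanSpace ℝ (Fin m))
    (W : ∀ i, H i) (e : ι × ι) : EuclideanSpace ℝ (Fin m) :=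
  Dt e (W e.1) + Dh e (W e.2)

/-- The objective of the local subproblem at node `i` in one scheduled-asynchronous
update: out-edges `(i,k)` use the previous value `W0 k` of the head node, while in-edges
`(k,i)` use the already-updated value `W1 k` of the tail node. -/
noncomputable def updObj {ι : Type*} [DecidableEq ι] {m : ℕ} {H : ι → Type*}
    [∀ i, NormedAddCommGroup (H i)] [∀ i, InnerProductSpace ℝ (H i)]
    (Ehat : Finset (ι × ι))
    (Dt : ∀ e : ι × ι, H e.1 →ₗ[ℝ] EuclideanSpace ℝ (Fin m))
    (Dh : ∀ e : ι × ι, H e.2 →ₗ[ℝ] EuclideanSpace ℝ (Fin m))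
    (ρ : ι × ι → ℝ) (f : ∀ i, H i → ℝ)
    (p : ι × ι → EuclideanSpace ℝ (Fin m))
    (W0 W1 : ∀ i, H i) (i : ι) (x : H i) : ℝ :=
  f i x
  + ∑ e ∈ Ehat.filter (fun e => e.1 = i),
      (⟪p e, Gmap Dt Dh (Function.update W0 i x) e⟫
        + ρ e / 2 * ‖Gmap Dt Dh (Function.update W0 i x) e‖ ^ 2)
  + ∑ e ∈ Ehat.filter (fun e => e.2 = i),
      (⟪p e, Gmap Dt Dh (Function.update W1 i x) e⟫
        + ρ e / 2 * ‖Gmap Dt Dh (Function.update W1 i x) e‖ ^ 2)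

/-- One scheduled-asynchronous update `(W0, p0) ↦ (W1, p1)`: every node `i` picks
`W1 i` as a minimizer of its local subproblem over `𝒲 i`, and every edge `(i,k) ∈ Ehat`
updates its multiplier by `p1 = p0 + ρ • G(W1)`. -/
def IsScheduledUpdate {ι : Type*} [DecidableEq ι] {m : ℕ} {H : ι → Type*}
    [∀ i, NormedAddCommGroup (H i)] [∀ i, InnerProductSpace ℝ (H i)]
    (Ehat : Finset (ι × ι))
    (Dt : ∀ e : ι × ι, H e.1 →ₗ[ℝ] EuclideanSpace ℝ (Fin m))
    (Dh : ∀ e : ι × ι, H e.2 →ₗ[ℝ] EuclideanSpace ℝ (Fin m))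
    (ρ : ι × ι → ℝ) (f : ∀ i, H i → ℝ) (𝒲 : ∀ i, Set (H i))
    (W0 W1 : ∀ i, H i) (p0 p1 : ι × ι → EuclideanSpace ℝ (Fin m)) : Prop :=
  (∀ i, W1 i ∈ 𝒲 i ∧ ∀ x ∈ 𝒲 i,
      updObj Ehat Dt Dh ρ f p0 W0 W1 i (W1 i) ≤ updObj Ehat Dt Dh ρ f p0 W0 W1 i x)
  ∧ ∀ e ∈ Ehat, p1 e = p0 e + ρ e • Gmap Dt Dh W1 e

theorem nonneg_of_forall_nonneg_mul_add_sq_mul {A B : ℝ}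
    (h : ∀ t : ℝ, 0 < t → t ≤ 1 → 0 ≤ t * A + t ^ 2 * B) : 0 ≤ A := by
  by_contra! hA
  have hpos : 0 < |B| + 1 - A := by linarith [abs_nonneg B]
  have ht : 0 < -A / (|B| + 1 - A) := div_pos (neg_pos.2 hA) hpos
  have ht1 : -A / (|B| + 1 - A) ≤ 1 := by
    rw [div_le_one hpos]
    linarith [abs_nonneg B]
  have hle := h _ ht ht1
  have hmul : -A / (|B| + 1 - A) * (|B| + 1 - A) = -A := div_mul_cancel₀ _ hpos.ne'
  generalize -A / (|B| + 1 - A) = t at *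
  have h0 : 0 ≤ A + t * B := by
    by_contra! hneg
    nlinarith
  nlinarith [mul_le_mul_of_nonneg_left (le_abs_self B) ht.le]

theorem inner_add_half_mul_norm_sq_add_smul {V : Type*} [NormedAddCommGroup V]
    [InnerProductSpace ℝ V] (c u v : V) (r t : ℝ) :
    ⟪c, u + t • v⟫ + r / 2 * ‖u + t • v‖ ^ 2
      = (⟪c, u⟫ + r / 2 * ‖u‖ ^ 2) + t * ⟪c + r • u, v⟫ + t ^ 2 * (r / 2 * ‖v‖ ^ 2) := by
  rw [norm_add_sq_real, norm_smul, mul_pow, Real.norm_eq_abs, sq_abs, inner_add_right,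
    inner_add_left, real_inner_smul_left, real_inner_smul_right, real_inner_smul_right]
  ring

section Gmap

variable {ι : Type*} [DecidableEq ι] {m : ℕ} {H : ι → Type*}
  [∀ i, NormedAddCommGroup (H i)] [∀ i, InnerProductSpace ℝ (H i)]
  (Dt : ∀ e : ι × ι, H e.1 →ₗ[ℝ] EuclideanSpace ℝ (Fin m))
  (Dh : ∀ e : ι × ι, H e.2 →ₗ[ℝ] EuclideanSpace ℝ (Fin m))

theorem Gmap_update_fst (W X : ∀ i, H i) {e : ι × ι} (he : e.1 ≠ e.2) {i : ι} (hi : e.1 = i) :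
    Gmap Dt Dh (Function.update W i (X i)) e = Dt e (X e.1) + Dh e (W e.2) := by
  subst hi
  simp [Gmap, Function.update_of_ne he.symm]

theorem Gmap_update_snd (W X : ∀ i, H i) {e : ι × ι} (he : e.1 ≠ e.2) {i : ι} (hi : e.2 = i) :
    Gmap Dt Dh (Function.update W i (X i)) e = Dt e (W e.1) + Dh e (X e.2) := by
  subst hi
  simp [Gmap, Function.update_of_ne he]

/-- First-order expansion, with quadratic remainder, of the coupling part of the local
objective along a line through the point `X i`. -/
theorem updObj_add_smul (Ehat : Finset (ι × ι)) (hEloop : ∀ e ∈ Ehat, e.1 ≠ e.2)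
    (ρ : ι × ι → ℝ) (f : ∀ i, H i → ℝ) (p : ι × ι → EuclideanSpace ℝ (Fin m))
    (W0 W1 X d : ∀ i, H i) (i : ι) (t : ℝ) :
    updObj Ehat Dt Dh ρ f p W0 W1 i (X i + t • d i)
      = updObj Ehat Dt Dh ρ f p W0 W1 i (X i) + (f i (X i + t • d i) - f i (X i))
        + t * (∑ e ∈ Ehat with e.1 = i,
              ⟪p e + ρ e • (Dt e (X e.1) + Dh e (W0 e.2)), Dt e (d e.1)⟫
            + ∑ e ∈ Ehat with e.2 = i,
              ⟪p e + ρ e • (Dt e (W1 e.1) + Dh e (X e.2)), Dh e (d e.2)⟫)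
        + t ^ 2 * (∑ e ∈ Ehat with e.1 = i, ρ e / 2 * ‖Dt e (d e.1)‖ ^ 2
            + ∑ e ∈ Ehat with e.2 = i, ρ e / 2 * ‖Dh e (d e.2)‖ ^ 2) := by
  have hout : ∑ e ∈ Ehat with e.1 = i,
      (⟪p e, Gmap Dt Dh (Function.update W0 i (X i + t • d i)) e⟫
        + ρ e / 2 * ‖Gmap Dt Dh (Function.update W0 i (X i + t • d i)) e‖ ^ 2)
      = ∑ e ∈ Ehat with e.1 = i, ((⟪p e, Gmap Dt Dh (Function.update W0 i (X i)) e⟫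
          + ρ e / 2 * ‖Gmap Dt Dh (Function.update W0 i (X i)) e‖ ^ 2)
        + t * ⟪p e + ρ e • (Dt e (X e.1) + Dh e (W0 e.2)), Dt e (d e.1)⟫
        + t ^ 2 * (ρ e / 2 * ‖Dt e (d e.1)‖ ^ 2)) := by
    refine sum_congr rfl fun e he => ?_
    obtain ⟨he, hi⟩ := mem_filter.1 he
    rw [Gmap_update_fst Dt Dh W0 (fun j => X j + t • d j) (hEloop e he) hi,
      Gmap_update_fst Dt Dh W0 X (hEloop e he) hi, ← inner_add_half_mul_norm_sq_add_smul,
      map_add, map_smul, add_right_comm]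
  have hin : ∑ e ∈ Ehat with e.2 = i,
      (⟪p e, Gmap Dt Dh (Function.update W1 i (X i + t • d i)) e⟫
        + ρ e / 2 * ‖Gmap Dt Dh (Function.update W1 i (X i + t • d i)) e‖ ^ 2)
      = ∑ e ∈ Ehat with e.2 = i, ((⟪p e, Gmap Dt Dh (Function.update W1 i (X i)) e⟫
          + ρ e / 2 * ‖Gmap Dt Dh (Function.update W1 i (X i)) e‖ ^ 2)
        + t * ⟪p e + ρ e • (Dt e (W1 e.1) + Dh e (X e.2)), Dh e (d e.2)⟫
        + t ^ 2 * (ρ e / 2 * ‖Dh e (d e.2)‖ ^ 2)) := by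
    refine sum_congr rfl fun e he => ?_
    obtain ⟨he, hi⟩ := mem_filter.1 he
    rw [Gmap_update_snd Dt Dh W1 (fun j => X j + t • d j) (hEloop e he) hi,
      Gmap_update_snd Dt Dh W1 X (hEloop e he) hi, ← inner_add_half_mul_norm_sq_add_smul,
      map_add, map_smul, add_assoc]
  simp only [sum_add_distrib, ← mul_sum] at hout hin
  simp only [updObj, sum_add_distrib]
  linear_combination hout + hin

end Gmap

/-- Eq. (A.2b) of the paper: for a feasible `Wstar` and one
scheduled-asynchronous update `(W0,p0) ↦ (W1,p1)`,
`∑ i (f i (W1 i) − f i (Wstar i)) ≤ −∑_e ⟪p1_e, r_e⟫ + ∑_e ρ_e ⟪D_ki(W0_k − W1_k), D_ik(Wstar_i − W1_i)⟫`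
with `r_e = G_e(W1)`. -/
theorem stmt2 {ι : Type*} [Fintype ι] [DecidableEq ι] {m : ℕ} {H : ι → Type*}
    [∀ i, NormedAddCommGroup (H i)] [∀ i, InnerProductSpace ℝ (H i)]
    [∀ i, FiniteDimensional ℝ (H i)]
    (Ehat : Finset (ι × ι)) (hEloop : ∀ e ∈ Ehat, e.1 ≠ e.2)
    (hEor : ∀ e ∈ Ehat, (e.2, e.1) ∉ Ehat)
    (Dt : ∀ e : ι × ι, H e.1 →ₗ[ℝ] EuclideanSpace ℝ (Fin m))
    (Dh : ∀ e : ι × ι, H e.2 →ₗ[ℝ] EuclideanSpace ℝ (Fin m))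
    (ρ : ι × ι → ℝ) (hρ : ∀ e ∈ Ehat, 0 < ρ e)
    (𝒲 : ∀ i, Set (H i))
    (h𝒲 : ∀ i, (𝒲 i).Nonempty ∧ IsCompact (𝒲 i) ∧ Convex ℝ (𝒲 i))
    (f : ∀ i, H i → ℝ)
    (hf : ∀ i, ConvexOn ℝ Set.univ (f i)) (hfd : ∀ i, Differentiable ℝ (f i))
    (Wstar : ∀ i, H i) (hWstar𝒲 : ∀ i, Wstar i ∈ 𝒲 i)
    (hfeas : ∀ e ∈ Ehat, Gmap Dt Dh Wstar e = 0)
    (W0 W1 : ∀ i, H i) (hW0 : ∀ i, W0 i ∈ 𝒲 i)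
    (p0 p1 : ι × ι → EuclideanSpace ℝ (Fin m))
    (hupd : IsScheduledUpdate Ehat Dt Dh ρ f 𝒲 W0 W1 p0 p1) :
    ∑ i, (f i (W1 i) - f i (Wstar i))
      ≤ - ∑ e ∈ Ehat, ⟪p1 e, Gmap Dt Dh W1 e⟫
        + ∑ e ∈ Ehat, ρ e * ⟪Dh e (W0 e.2 - W1 e.2), Dt e (Wstar e.1 - W1 e.1)⟫ := by
  obtain ⟨hmin, hp⟩ := hupd
  set d : ∀ i, H i := fun i => Wstar i - W1 i with hd
  have hnode : ∀ i, f i (W1 i) - f i (Wstar i) ≤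
      ∑ e ∈ Ehat with e.1 = i,
          ⟪p0 e + ρ e • (Dt e (W1 e.1) + Dh e (W0 e.2)), Dt e (d e.1)⟫
        + ∑ e ∈ Ehat with e.2 = i,
          ⟪p0 e + ρ e • (Dt e (W1 e.1) + Dh e (W1 e.2)), Dh e (d e.2)⟫ := by
    intro i
    rw [← sub_nonneg]
    refine nonneg_of_forall_nonneg_mul_add_sq_mul
      (B := ∑ e ∈ Ehat with e.1 = i, ρ e / 2 * ‖Dt e (d e.1)‖ ^ 2
        + ∑ e ∈ Ehat with e.2 = i, ρ e / 2 * ‖Dh e (d e.2)‖ ^ 2) fun t ht ht1 => ?_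
    have hline : W1 i + t • d i = (1 - t) • W1 i + t • Wstar i := by
      simp only [hd]
      module
    have hmem : W1 i + t • d i ∈ 𝒲 i := by
      rw [hline]
      exact (h𝒲 i).2.2 (hmin i).1 (hWstar𝒲 i) (sub_nonneg.2 ht1) ht.le (by ring)
    have hconv : f i (W1 i + t • d i) ≤ (1 - t) * f i (W1 i) + t * f i (Wstar i) := by
      rw [hline]
      exact (hf i).2 (Set.mem_univ _) (Set.mem_univ _) (sub_nonneg.2 ht1) ht.le (by ring)
    have hle := (hmin i).2 _ hmem
    rw [updObj_add_smul Dt Dh Ehat hEloop] at hle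
    linarith
  calc ∑ i, (f i (W1 i) - f i (Wstar i))
      ≤ ∑ i, (∑ e ∈ Ehat with e.1 = i,
            ⟪p0 e + ρ e • (Dt e (W1 e.1) + Dh e (W0 e.2)), Dt e (d e.1)⟫
          + ∑ e ∈ Ehat with e.2 = i,
            ⟪p0 e + ρ e • (Dt e (W1 e.1) + Dh e (W1 e.2)), Dh e (d e.2)⟫) :=
        sum_le_sum fun i _ => hnode i
    _ = ∑ e ∈ Ehat, (⟪p0 e + ρ e • (Dt e (W1 e.1) + Dh e (W0 e.2)), Dt e (d e.1)⟫
          + ⟪p0 e + ρ e • (Dt e (W1 e.1) + Dh e (W1 e.2)), Dh e (d e.2)⟫) := by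
        rw [sum_add_distrib, sum_add_distrib, sum_fiberwise, sum_fiberwise]
    _ = ∑ e ∈ Ehat, (-⟪p1 e, Gmap Dt Dh W1 e⟫
          + ρ e * ⟪Dh e (W0 e.2 - W1 e.2), Dt e (Wstar e.1 - W1 e.1)⟫) := by
        refine sum_congr rfl fun e he => ?_
        have hG : Gmap Dt Dh W1 e = -(Dt e (d e.1) + Dh e (d e.2)) := by
          have h0 := hfeas e he
          simp only [Gmap, hd, map_sub] at h0 ⊢
          rw [← add_sub_add_comm, h0, zero_sub, neg_neg]
        have hout : p0 e + ρ e • (Dt e (W1 e.1) + Dh e (W0 e.2))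
            = p1 e + ρ e • Dh e (W0 e.2 - W1 e.2) := by
          rw [hp e he, Gmap, map_sub]
          module
        have hin : p0 e + ρ e • (Dt e (W1 e.1) + Dh e (W1 e.2)) = p1 e := (hp e he).symm
        rw [hout, hin, hG, inner_neg_right, neg_neg, inner_add_left, inner_add_right,
          real_inner_smul_left]
        ring
    _ = _ := by rw [sum_add_distrib, sum_neg_distrib]
end

section
/- Assume each f_i is additionally differentiable, and suppose (W*, p*) is an optimal primal-dual pair: W* is feasible (G_ik(W*_i, W*_k) = 0 for all (i,k) ∈ Ê) and W* minimizes the Lagrangian W ↦ Σ_{i∈N} f_i(W_i) + Σ_{(i,k)∈Ê} ⟨p*_ik, G_ik(W_i, W_k)⟩ over ∏_{i∈N} 𝒲_i. Define V(W, p) := Σ_{(i,k)∈Ê} ( ‖p_ik − p*_ik‖²/ρ_ik + ρ_ik ‖D_ki(W_k − W*_k)‖² ). Let (Wⁿ, pⁿ) be given and let (W^{n+1}, p^{n+1}) be produced by one scheduled-asynchronous update. Then V(W^{n+1}, p^{n+1}) − V(Wⁿ, pⁿ) ≤ − Σ_{(i,k)∈Ê} ρ_ik ‖ r_ik^{n+1}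 − D_ki(W_k^{n+1} − W_kⁿ) ‖², where r_ik^{n+1} := G_ik(W_i^{n+1}, W_k^{n+1}). In particular, V is non-increasing along the iterates. -/
open Finset RealInnerProductSpace

theorem nonneg_of_forall_mul_add_sq_mul_nonneg {a q : ℝ}
    (h : ∀ t : ℝ, 0 < t → t ≤ 1 → 0 ≤ t * a + t ^ 2 * q) : 0 ≤ a := by
  by_contra! ha
  have hd : 0 < |q| - a := by linarith [abs_nonneg q]
  have hd' : 0 < 2 * (|q| - a) := by linarith
  have ht : 0 < -a / (2 * (|q| - a)) := div_pos (by linarith) hd'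
  have ht1 : -a / (2 * (|q| - a)) ≤ 1 := by
    rw [div_le_one hd']
    linarith [abs_nonneg q]
  have hmul : -a / (2 * (|q| - a)) * (2 * (|q| - a)) = -a := div_mul_cancel₀ _ hd'.ne'
  have key := h _ ht ht1
  set t := -a / (2 * (|q| - a))
  have h0 : 0 ≤ a + t * q := by
    refine nonneg_of_mul_nonneg_right (a := t) ?_ ht
    linarith
  nlinarith [mul_le_mul_of_nonneg_left (le_abs_self q) ht.le, mul_pos ht (neg_pos.2 ha)]

theorem inner_add_norm_sq_line {E : Type*} [NormedAddCommGroup E] [InnerProductSpace ℝ E]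
    (p u v : E) (r t : ℝ) :
    ⟪p, u + t • v⟫ + r / 2 * ‖u + t • v‖ ^ 2
      = (⟪p, u⟫ + r / 2 * ‖u‖ ^ 2) + t * ⟪p + r • u, v⟫ + t ^ 2 * (r / 2 * ‖v‖ ^ 2) := by
  rw [norm_add_sq_real, norm_smul, mul_pow, Real.norm_eq_abs, sq_abs]
  simp only [inner_add_left, inner_add_right, inner_smul_left, inner_smul_right, conj_trivial]
  ring

section Update

variable {ι : Type*} [DecidableEq ι] {m : ℕ} {H : ι → Type*}
  [∀ i, NormedAddCommGroup (H i)] [∀ i, InnerProductSpace ℝ (H i)]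
  (Dt : ∀ e : ι × ι, H e.1 →ₗ[ℝ] EuclideanSpace ℝ (Fin m))
  (Dh : ∀ e : ι × ι, H e.2 →ₗ[ℝ] EuclideanSpace ℝ (Fin m))

theorem Gmap_update_tail {e : ι × ι} (he : e.1 ≠ e.2) (W : ∀ i, H i) (x : H e.1) :
    Gmap Dt Dh (Function.update W e.1 x) e = Dt e x + Dh e (W e.2) := by
  simp [Gmap, Function.update_of_ne he.symm]

theorem Gmap_update_head {e : ι × ι} (he : e.1 ≠ e.2) (W : ∀ i, H i) (x : H e.2) :
    Gmap Dt Dh (Function.update W e.2 x) e = Dt e (W e.1) + Dh e x := by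
  simp [Gmap, Function.update_of_ne he]

theorem updObj_line {Ehat : Finset (ι × ι)} (hE : ∀ e ∈ Ehat, e.1 ≠ e.2)
    (ρ : ι × ι → ℝ) (f : ∀ i, H i → ℝ) (p : ι × ι → EuclideanSpace ℝ (Fin m))
    (W0 W1 X Y : ∀ i, H i) (i : ι) (t : ℝ) :
    updObj Ehat Dt Dh ρ f p W0 W1 i (X i + t • Y i)
      = updObj Ehat Dt Dh ρ f p W0 W1 i (X i) + (f i (X i + t • Y i) - f i (X i))
        + t * (∑ e ∈ Ehat with e.1 = i,
              ⟪p e + ρ e • (Dt e (X e.1) + Dh e (W0 e.2)), Dt e (Y e.1)⟫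
            + ∑ e ∈ Ehat with e.2 = i,
              ⟪p e + ρ e • (Dt e (W1 e.1) + Dh e (X e.2)), Dh e (Y e.2)⟫)
        + t ^ 2 * (∑ e ∈ Ehat with e.1 = i, ρ e / 2 * ‖Dt e (Y e.1)‖ ^ 2
            + ∑ e ∈ Ehat with e.2 = i, ρ e / 2 * ‖Dh e (Y e.2)‖ ^ 2) := by
  have tail : ∀ x : ∀ i, H i, ∀ e ∈ Ehat.filter (fun e => e.1 = i),
      Gmap Dt Dh (Function.update W0 i (x i)) e = Dt e (x e.1) + Dh e (W0 e.2) := by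
    intro x e he
    obtain ⟨heE, rfl⟩ := mem_filter.1 he
    exact Gmap_update_tail Dt Dh (hE e heE) W0 _
  have head : ∀ x : ∀ i, H i, ∀ e ∈ Ehat.filter (fun e => e.2 = i),
      Gmap Dt Dh (Function.update W1 i (x i)) e = Dt e (W1 e.1) + Dh e (x e.2) := by
    intro x e he
    obtain ⟨heE, rfl⟩ := mem_filter.1 he
    exact Gmap_update_head Dt Dh (hE e heE) W1 _
  have h1 : ∑ e ∈ Ehat with e.1 = i,
        (⟪p e, Gmap Dt Dh (Function.update W0 i (X i + t • Y i)) e⟫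
          + ρ e / 2 * ‖Gmap Dt Dh (Function.update W0 i (X i + t • Y i)) e‖ ^ 2)
      = ∑ e ∈ Ehat with e.1 = i,
        ((⟪p e, Gmap Dt Dh (Function.update W0 i (X i)) e⟫
          + ρ e / 2 * ‖Gmap Dt Dh (Function.update W0 i (X i)) e‖ ^ 2)
        + t * ⟪p e + ρ e • (Dt e (X e.1) + Dh e (W0 e.2)), Dt e (Y e.1)⟫
        + t ^ 2 * (ρ e / 2 * ‖Dt e (Y e.1)‖ ^ 2)) := by
    refine sum_congr rfl fun e he => ?_
    rw [tail X e he, tail (fun i => X i + t • Y i) e he, ← inner_add_norm_sq_line,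
      map_add, map_smul, add_right_comm]
  have h2 : ∑ e ∈ Ehat with e.2 = i,
        (⟪p e, Gmap Dt Dh (Function.update W1 i (X i + t • Y i)) e⟫
          + ρ e / 2 * ‖Gmap Dt Dh (Function.update W1 i (X i + t • Y i)) e‖ ^ 2)
      = ∑ e ∈ Ehat with e.2 = i,
        ((⟪p e, Gmap Dt Dh (Function.update W1 i (X i)) e⟫
          + ρ e / 2 * ‖Gmap Dt Dh (Function.update W1 i (X i)) e‖ ^ 2)
        + t * ⟪p e + ρ e • (Dt e (W1 e.1) + Dh e (X e.2)), Dh e (Y e.2)⟫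
        + t ^ 2 * (ρ e / 2 * ‖Dh e (Y e.2)‖ ^ 2)) := by
    refine sum_congr rfl fun e he => ?_
    rw [head X e he, head (fun i => X i + t • Y i) e he, ← inner_add_norm_sq_line,
      map_add, map_smul, add_assoc]
  unfold updObj
  rw [h1, h2]
  simp only [sum_add_distrib, ← mul_sum]
  ring

/-- The variational inequality satisfied by a minimizer of the local subproblem. -/
theorem updObj_variational {Ehat : Finset (ι × ι)} (hE : ∀ e ∈ Ehat, e.1 ≠ e.2)
    (ρ : ι × ι → ℝ) (f : ∀ i, H i → ℝ) (p : ι × ι → EuclideanSpace ℝ (Fin m))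
    (W0 W1 Z : ∀ i, H i) (i : ι) {S : Set (H i)} (hS : Convex ℝ S)
    (hf : ConvexOn ℝ Set.univ (f i)) (hW1 : W1 i ∈ S) (hZ : Z i ∈ S)
    (hmin : ∀ x ∈ S, updObj Ehat Dt Dh ρ f p W0 W1 i (W1 i) ≤ updObj Ehat Dt Dh ρ f p W0 W1 i x) :
    0 ≤ f i (Z i) - f i (W1 i)
      + (∑ e ∈ Ehat with e.1 = i,
          ⟪p e + ρ e • (Dt e (W1 e.1) + Dh e (W0 e.2)), Dt e (Z e.1 - W1 e.1)⟫
        + ∑ e ∈ Ehat with e.2 = i,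
          ⟪p e + ρ e • (Dt e (W1 e.1) + Dh e (W1 e.2)), Dh e (Z e.2 - W1 e.2)⟫) := by
  refine nonneg_of_forall_mul_add_sq_mul_nonneg
    (q := ∑ e ∈ Ehat with e.1 = i, ρ e / 2 * ‖Dt e (Z e.1 - W1 e.1)‖ ^ 2
      + ∑ e ∈ Ehat with e.2 = i, ρ e / 2 * ‖Dh e (Z e.2 - W1 e.2)‖ ^ 2) fun t ht ht1 => ?_
  have hmem := hmin _ (hS.add_smul_sub_mem hW1 hZ ⟨ht.le, ht1⟩)
  rw [updObj_line Dt Dh hE ρ f p W0 W1 W1 (fun i => Z i - W1 i) i t] at hmem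
  have hconv := hf.2 (Set.mem_univ (W1 i)) (Set.mem_univ (Z i))
    (sub_nonneg.2 ht1) ht.le (sub_add_cancel 1 t)
  have hpt : (1 - t) • W1 i + t • Z i = W1 i + t • (Z i - W1 i) := by module
  rw [hpt, smul_eq_mul, smul_eq_mul] at hconv
  linarith

end Update

/-- The change of one edge's contribution to the Lyapunov function, in terms of the residual `r`,
the head displacement `d`, the head error `b` and the multiplier error `q` after the update. -/
theorem lyapunov_edge_identity {E : Type*} [NormedAddCommGroup E] [InnerProductSpace ℝ E]
    (q r b d : E) {c : ℝ} (hc : 0 < c) :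
    (‖q‖ ^ 2 / c + c * ‖b‖ ^ 2) - (‖q - c • r‖ ^ 2 / c + c * ‖b - d‖ ^ 2)
      = 2 * (⟪q, r⟫ - c * ⟪d, r⟫ + c * ⟪d, b⟫) - c * ‖r - d‖ ^ 2 := by
  rw [norm_sub_sq_real, norm_sub_sq_real, norm_sub_sq_real, norm_smul, mul_pow, Real.norm_eq_abs,
    sq_abs, inner_smul_right, real_inner_comm d b, real_inner_comm d r]
  field_simp
  ring

/-- monotonicity of the LaSalle function: with
`V(W,p) = ∑_e (‖p_e − pstar_e‖²/ρ_e + ρ_e ‖D_ki(W_k − Wstar_k)‖²)`, one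
scheduled-asynchronous update satisfies
`V(W1,p1) − V(W0,p0) ≤ −∑_e ρ_e ‖r_e − D_ki(W1_k − W0_k)‖²` with `r_e = G_e(W1)`. -/
theorem stmt4 {ι : Type*} [Fintype ι] [DecidableEq ι] {m : ℕ} {H : ι → Type*}
    [∀ i, NormedAddCommGroup (H i)] [∀ i, InnerProductSpace ℝ (H i)]
    [∀ i, FiniteDimensional ℝ (H i)]
    (Ehat : Finset (ι × ι)) (hEloop : ∀ e ∈ Ehat, e.1 ≠ e.2)
    (hEor : ∀ e ∈ Ehat, (e.2, e.1) ∉ Ehat)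
    (Dt : ∀ e : ι × ι, H e.1 →ₗ[ℝ] EuclideanSpace ℝ (Fin m))
    (Dh : ∀ e : ι × ι, H e.2 →ₗ[ℝ] EuclideanSpace ℝ (Fin m))
    (ρ : ι × ι → ℝ) (hρ : ∀ e ∈ Ehat, 0 < ρ e)
    (𝒲 : ∀ i, Set (H i))
    (h𝒲 : ∀ i, (𝒲 i).Nonempty ∧ IsCompact (𝒲 i) ∧ Convex ℝ (𝒲 i))
    (f : ∀ i, H i → ℝ)
    (hf : ∀ i, ConvexOn ℝ Set.univ (f i)) (hfd : ∀ i, Differentiable ℝ (f i))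
    (Wstar : ∀ i, H i) (pstar : ι × ι → EuclideanSpace ℝ (Fin m))
    (hWstar𝒲 : ∀ i, Wstar i ∈ 𝒲 i)
    (hfeas : ∀ e ∈ Ehat, Gmap Dt Dh Wstar e = 0)
    (hlagr : ∀ W : ∀ i, H i, (∀ i, W i ∈ 𝒲 i) →
      (∑ i, f i (Wstar i)) + ∑ e ∈ Ehat, ⟪pstar e, Gmap Dt Dh Wstar e⟫ ≤
        (∑ i, f i (W i)) + ∑ e ∈ Ehat, ⟪pstar e, Gmap Dt Dh W e⟫)
    (W0 W1 : ∀ i, H i) (hW0 : ∀ i, W0 i ∈ 𝒲 i)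
    (p0 p1 : ι × ι → EuclideanSpace ℝ (Fin m))
    (hupd : IsScheduledUpdate Ehat Dt Dh ρ f 𝒲 W0 W1 p0 p1) :
    (∑ e ∈ Ehat, (‖p1 e - pstar e‖ ^ 2 / ρ e + ρ e * ‖Dh e (W1 e.2 - Wstar e.2)‖ ^ 2))
      - (∑ e ∈ Ehat, (‖p0 e - pstar e‖ ^ 2 / ρ e + ρ e * ‖Dh e (W0 e.2 - Wstar e.2)‖ ^ 2))
      ≤ - ∑ e ∈ Ehat, ρ e * ‖Gmap Dt Dh W1 e - Dh e (W1 e.2 - W0 e.2)‖ ^ 2 := by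
  obtain ⟨hmin, hp⟩ := hupd
  have hvi := sum_nonneg fun i (_ : i ∈ univ) =>
    updObj_variational Dt Dh hEloop ρ f p0 W0 W1 Wstar i (h𝒲 i).2.2 (hf i) (hmin i).1
      (hWstar𝒲 i) (hmin i).2
  simp only [sum_add_distrib, sum_sub_distrib, sum_fiberwise] at hvi
  have hL := hlagr W1 fun i => (hmin i).1
  have hstar : ∑ e ∈ Ehat, ⟪pstar e, Gmap Dt Dh Wstar e⟫ = 0 :=
    sum_eq_zero fun e he => by rw [hfeas e he, inner_zero_right]
  have hcross : ∀ e ∈ Ehat,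
      ⟪p0 e + ρ e • (Dt e (W1 e.1) + Dh e (W0 e.2)), Dt e (Wstar e.1 - W1 e.1)⟫
        + ⟪p0 e + ρ e • (Dt e (W1 e.1) + Dh e (W1 e.2)), Dh e (Wstar e.2 - W1 e.2)⟫
        + ⟪pstar e, Gmap Dt Dh W1 e⟫
      = -(⟪p1 e - pstar e, Gmap Dt Dh W1 e⟫
          - ρ e * ⟪Dh e (W1 e.2 - W0 e.2), Gmap Dt Dh W1 e⟫
          + ρ e * ⟪Dh e (W1 e.2 - W0 e.2), Dh e (W1 e.2 - Wstar e.2)⟫) := by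
    intro e he
    have hs : Dt e (Wstar e.1) = - Dh e (Wstar e.2) := eq_neg_of_add_eq_zero_left (hfeas e he)
    rw [hp e he]
    simp only [Gmap, map_sub, hs, inner_add_left, inner_add_right, inner_sub_left,
      inner_sub_right, inner_neg_right, inner_smul_left, conj_trivial]
    ring
  have hedge : ∀ e ∈ Ehat,
      (‖p1 e - pstar e‖ ^ 2 / ρ e + ρ e * ‖Dh e (W1 e.2 - Wstar e.2)‖ ^ 2)
        - (‖p0 e - pstar e‖ ^ 2 / ρ e + ρ e * ‖Dh e (W0 e.2 - Wstar e.2)‖ ^ 2)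
      = 2 * (⟪p1 e - pstar e, Gmap Dt Dh W1 e⟫
          - ρ e * ⟪Dh e (W1 e.2 - W0 e.2), Gmap Dt Dh W1 e⟫
          + ρ e * ⟪Dh e (W1 e.2 - W0 e.2), Dh e (W1 e.2 - Wstar e.2)⟫)
        - ρ e * ‖Gmap Dt Dh W1 e - Dh e (W1 e.2 - W0 e.2)‖ ^ 2 := by
    intro e he
    rw [← lyapunov_edge_identity _ _ _ _ (hρ e he), ← map_sub, sub_sub_sub_cancel_left,
      show p1 e - pstar e - ρ e • Gmap Dt Dh W1 e = p0 e - pstar e by rw [hp e he]; abel]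
  have hsum := sum_congr rfl hcross
  rw [sum_add_distrib, sum_add_distrib, sum_neg_distrib] at hsum
  rw [← sum_sub_distrib, sum_congr rfl hedge, sum_sub_distrib, ← mul_sum]
  linarith
end

section
/- Assume each f_i is additionally differentiable, the orientation Ê is acyclic, each update subproblem has a unique minimizer, and the constrained problem admits a unique optimal primal-dual pair (W*, p*) (W* feasible and minimizing the Lagrangian at p* over ∏ 𝒲_i). Let (Wⁿ, pⁿ)_{n≥0} be a trajectory of the scheduled-asynchronous update such that, for every n ≥ 0 and every (i,k) ∈ Ê, r_ik^{n+1} = D_ki(W_k^{n+1} − W_kⁿ), where r_ik^{n+1} := G_ik(W_i^{n+1}, W_k^{n+1}). Then there exists a finite n₀ such that r_ik^{n₀+1} = 0 for all (i,k) ∈ Ê, W^{n₀+1} = W*, and p^{n₀+1} = p*. -/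
open Finset RealInnerProductSpace

/-- First-order optimality: if `x` minimizes `f + q` over a convex set, with `f` convex and `q`
quadratic along the segment from `x` to `y` with slope `l` at `x`, then `x` beats `y` for the
problem in which `q` is linearized at `x`. -/
lemma ConvexOn.le_add_slope_of_isMinOn {E : Type*} [AddCommGroup E] [Module ℝ E]
    {f q : E → ℝ} {C : Set E} (hf : ConvexOn ℝ Set.univ f) (hC : Convex ℝ C) {x y : E}
    (hx : x ∈ C) (hy : y ∈ C) (hmin : ∀ z ∈ C, f x + q x ≤ f z + q z) {l k : ℝ}
    (hq : ∀ t : ℝ, q (x + t • (y - x)) = q x + t * l + t ^ 2 * k) :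
    f x ≤ f y + l := by
  have key : ∀ t : ℝ, 0 < t → t ≤ 1 → 0 ≤ (f y - f x + l) + t * k := by
    intro t ht ht1
    have hz : x + t • (y - x) = (1 - t) • x + t • y := by module
    have h1 := hmin _ (hC hx hy (sub_nonneg.2 ht1) ht.le (by ring))
    have h2 := hf.2 (Set.mem_univ x) (Set.mem_univ y) (sub_nonneg.2 ht1) ht.le (by ring)
    rw [← hz] at h1 h2
    rw [hq t] at h1
    simp only [smul_eq_mul] at h2
    have h3 : 0 ≤ t * ((f y - f x + l) + t * k) := by nlinarith
    exact nonneg_of_mul_nonneg_right h3 ht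
  by_contra! hlt
  set A := f y - f x + l with hA
  have hA0 : A < 0 := by rw [hA]; linarith
  have hD : 0 < -A + |k| := by have := abs_nonneg k; linarith
  have h := key (-A / (-A + |k|)) (div_pos (by linarith) hD)
    ((div_le_one hD).2 (by linarith [abs_nonneg k]))
  have h4 : 0 ≤ (A + -A / (-A + |k|) * k) * (-A + |k|) := mul_nonneg h hD.le
  have h5 : (A + -A / (-A + |k|) * k) * (-A + |k|) = A * (-A + |k|) + -A * k := by
    field_simp
  nlinarith [le_abs_self k]

section Coupling

variable {ι : Type*} [DecidableEq ι] {m : ℕ} {H : ι → Type*}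
  [∀ i, NormedAddCommGroup (H i)] [∀ i, InnerProductSpace ℝ (H i)]
  (Dt : ∀ e : ι × ι, H e.1 →ₗ[ℝ] EuclideanSpace ℝ (Fin m))
  (Dh : ∀ e : ι × ι, H e.2 →ₗ[ℝ] EuclideanSpace ℝ (Fin m))

lemma Gmap_update_eq_add (W : ∀ i, H i) (i : ι) (x y : H i) (e : ι × ι) :
    Gmap Dt Dh (Function.update W i y) e =
      Gmap Dt Dh (Function.update W i x) e + Gmap Dt Dh (Pi.single i (y - x)) e := by
  have h : Function.update W i y = Function.update W i x + Pi.single i (y - x) := by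
    funext j
    by_cases hj : j = i
    · subst hj; simp
    · simp [hj]
  simp only [h, Gmap, Pi.add_apply, map_add]
  abel

lemma Gmap_single_smul (i : ι) (t : ℝ) (v : H i) (e : ι × ι) :
    Gmap Dt Dh (Pi.single i (t • v)) e = t • Gmap Dt Dh (Pi.single i v) e := by
  simp [Gmap, Pi.single_smul]

lemma Gmap_single_neg (i : ι) (v : H i) (e : ι × ι) :
    Gmap Dt Dh (Pi.single i (-v)) e = -Gmap Dt Dh (Pi.single i v) e := by
  simpa using Gmap_single_smul Dt Dh i (-1) v e

lemma Gmap_single_fst {e : ι × ι} (he : e.1 ≠ e.2) (v : H e.1) :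
    Gmap Dt Dh (Pi.single e.1 v) e = Dt e v := by
  simp [Gmap, he.symm]

lemma Gmap_single_snd {e : ι × ι} (he : e.1 ≠ e.2) (v : H e.2) :
    Gmap Dt Dh (Pi.single e.2 v) e = Dh e v := by
  simp [Gmap, he]

lemma augmented_sum_update (s : Finset (ι × ι)) (ρ : ι × ι → ℝ)
    (p : ι × ι → EuclideanSpace ℝ (Fin m)) (W : ∀ i, H i) (i : ι) (x v : H i) (t : ℝ) :
    ∑ e ∈ s, (⟪p e, Gmap Dt Dh (Function.update W i (x + t • v)) e⟫
        + ρ e / 2 * ‖Gmap Dt Dh (Function.update W i (x + t • v)) e‖ ^ 2) =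
      ∑ e ∈ s, (⟪p e, Gmap Dt Dh (Function.update W i x) e⟫
        + ρ e / 2 * ‖Gmap Dt Dh (Function.update W i x) e‖ ^ 2)
      + t * ∑ e ∈ s, ⟪p e + ρ e • Gmap Dt Dh (Function.update W i x) e,
          Gmap Dt Dh (Pi.single i v) e⟫
      + t ^ 2 * ∑ e ∈ s, ρ e / 2 * ‖Gmap Dt Dh (Pi.single i v) e‖ ^ 2 := by
  rw [Finset.mul_sum, Finset.mul_sum, ← Finset.sum_add_distrib, ← Finset.sum_add_distrib]
  refine Finset.sum_congr rfl fun e _ => ?_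
  rw [Gmap_update_eq_add Dt Dh W i x, add_sub_cancel_left, Gmap_single_smul,
    norm_add_sq_real, inner_add_right, inner_add_left, norm_smul, mul_pow, Real.norm_eq_abs,
    sq_abs]
  simp only [real_inner_smul_left, real_inner_smul_right]
  ring

/-- The variational inequality satisfied by a minimizer of a local subproblem. -/
lemma updObj_first_order {Ehat : Finset (ι × ι)} {ρ : ι × ι → ℝ} {f : ∀ i, H i → ℝ}
    {p : ι × ι → EuclideanSpace ℝ (Fin m)} {W0 W1 : ∀ i, H i} {i : ι} {C : Set (H i)}
    (hf : ConvexOn ℝ Set.univ (f i)) (hC : Convex ℝ C) {x y : H i} (hx : x ∈ C) (hy : y ∈ C)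
    (hmin : ∀ z ∈ C, updObj Ehat Dt Dh ρ f p W0 W1 i x ≤ updObj Ehat Dt Dh ρ f p W0 W1 i z) :
    f i x ≤ f i y
      + ((∑ e ∈ Ehat.filter (fun e => e.1 = i),
          ⟪p e + ρ e • Gmap Dt Dh (Function.update W0 i x) e,
            Gmap Dt Dh (Pi.single i (y - x)) e⟫)
        + ∑ e ∈ Ehat.filter (fun e => e.2 = i),
          ⟪p e + ρ e • Gmap Dt Dh (Function.update W1 i x) e,
            Gmap Dt Dh (Pi.single i (y - x)) e⟫) := by
  refine ConvexOn.le_add_slope_of_isMinOn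
    (q := fun z => updObj Ehat Dt Dh ρ f p W0 W1 i z - f i z) hf hC hx hy
    (fun z hz => by simpa using hmin z hz)
    (k := (∑ e ∈ Ehat.filter (fun e => e.1 = i),
        ρ e / 2 * ‖Gmap Dt Dh (Pi.single i (y - x)) e‖ ^ 2)
      + ∑ e ∈ Ehat.filter (fun e => e.2 = i),
        ρ e / 2 * ‖Gmap Dt Dh (Pi.single i (y - x)) e‖ ^ 2) fun t => ?_
  simp only [updObj, augmented_sum_update]
  ring

/-- Under the invariance identity, the variational inequality of node `i` involves the old
multipliers on out-edges and the new multipliers on in-edges. -/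
lemma IsScheduledUpdate.first_order {Ehat : Finset (ι × ι)}
    {ρ : ι × ι → ℝ} {f : ∀ i, H i → ℝ} {𝒲 : ∀ i, Set (H i)} {W0 W1 : ∀ i, H i}
    {p0 p1 : ι × ι → EuclideanSpace ℝ (Fin m)}
    (hupd : IsScheduledUpdate Ehat Dt Dh ρ f 𝒲 W0 W1 p0 p1)
    (hEloop : ∀ e ∈ Ehat, e.1 ≠ e.2) {i : ι} (hf : ConvexOn ℝ Set.univ (f i))
    (hC : Convex ℝ (𝒲 i))
    (hr : ∀ e ∈ Ehat, Gmap Dt Dh W1 e = Dh e (W1 e.2 - W0 e.2)) {y : H i} (hy : y ∈ 𝒲 i) :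
    f i (W1 i) ≤ f i y
      + ((∑ e ∈ Ehat.filter (fun e => e.1 = i),
          ⟪p0 e, Gmap Dt Dh (Pi.single i (y - W1 i)) e⟫)
        + ∑ e ∈ Ehat.filter (fun e => e.2 = i),
          ⟪p1 e, Gmap Dt Dh (Pi.single i (y - W1 i)) e⟫) := by
  have h := updObj_first_order Dt Dh hf hC (hupd.1 i).1 hy (hupd.1 i).2
  rw [Finset.sum_congr rfl (g := fun e => ⟪p0 e, Gmap Dt Dh (Pi.single i (y - W1 i)) e⟫)
      (s₁ := Ehat.filter (fun e => e.1 = i)),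
    Finset.sum_congr rfl (g := fun e => ⟪p1 e, Gmap Dt Dh (Pi.single i (y - W1 i)) e⟫)
      (s₁ := Ehat.filter (fun e => e.2 = i))] at h
  · exact h
  · intro e he
    rw [Function.update_eq_self, ← hupd.2 e (Finset.mem_filter.1 he).1]
  · intro e he
    obtain ⟨heE, rfl⟩ := Finset.mem_filter.1 he
    have h0 : Gmap Dt Dh (Function.update W0 e.1 (W1 e.1)) e = 0 := by
      have := hr e heE
      simp only [Gmap, map_sub] at this
      simp only [Gmap, Function.update_self, Function.update_of_ne (hEloop e heE).symm]
      rw [← sub_eq_zero] at this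
      rw [← this]
      abel
    rw [h0, smul_zero, add_zero]

/-- If the heads of all out-edges of `i` did not move in an update, then `i` itself does not move
in the next one. -/
lemma IsScheduledUpdate.eq_of_heads_eq {Ehat : Finset (ι × ι)}
    {ρ : ι × ι → ℝ} {f : ∀ i, H i → ℝ} {𝒲 : ∀ i, Set (H i)} {W0 W1 W2 : ∀ i, H i}
    {p0 p1 p2 : ι × ι → EuclideanSpace ℝ (Fin m)}
    (hupd : IsScheduledUpdate Ehat Dt Dh ρ f 𝒲 W0 W1 p0 p1)
    (hupd' : IsScheduledUpdate Ehat Dt Dh ρ f 𝒲 W1 W2 p1 p2)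
    (hEloop : ∀ e ∈ Ehat, e.1 ≠ e.2) (hρ : ∀ e ∈ Ehat, 0 < ρ e)
    {i : ι} (hf : ConvexOn ℝ Set.univ (f i)) (hC : Convex ℝ (𝒲 i))
    (hr : ∀ e ∈ Ehat, Gmap Dt Dh W1 e = Dh e (W1 e.2 - W0 e.2))
    (hr' : ∀ e ∈ Ehat, Gmap Dt Dh W2 e = Dh e (W2 e.2 - W1 e.2))
    (huniq : ∀ x y : H i,
      (x ∈ 𝒲 i ∧ ∀ z ∈ 𝒲 i,
        updObj Ehat Dt Dh ρ f p0 W0 W1 i x ≤ updObj Ehat Dt Dh ρ f p0 W0 W1 i z) →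
      (y ∈ 𝒲 i ∧ ∀ z ∈ 𝒲 i,
        updObj Ehat Dt Dh ρ f p0 W0 W1 i y ≤ updObj Ehat Dt Dh ρ f p0 W0 W1 i z) → x = y)
    (hheads : ∀ e ∈ Ehat, e.1 = i → W1 e.2 = W0 e.2) : W2 i = W1 i := by
  have hout : ∀ e ∈ Ehat.filter (fun e => e.1 = i),
      Gmap Dt Dh (Pi.single i (W2 i - W1 i)) e = 0 := by
    intro e he
    obtain ⟨heE, rfl⟩ := Finset.mem_filter.1 he
    have h1 := hr e heE
    have h2 := hr' e heE
    simp only [Gmap, map_sub, hheads e heE rfl] at h1 h2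
    rw [Gmap_single_fst Dt Dh (hEloop e heE), map_sub]
    rw [← sub_eq_zero] at h1 h2
    rw [← sub_self (0 : EuclideanSpace ℝ (Fin m))]
    nth_rewrite 1 [← h2]
    rw [← h1]
    abel
  have hneg : W1 i - W2 i = -(W2 i - W1 i) := by abel
  have h1 := hupd.first_order Dt Dh hEloop hf hC hr (hupd'.1 i).1
  have h2 := hupd'.first_order Dt Dh hEloop hf hC hr' (hupd.1 i).1
  simp only [hneg, Gmap_single_neg] at h2
  rw [Finset.sum_eq_zero (s := Ehat.filter (fun e => e.1 = i))
    (fun e he => by rw [hout e he, inner_zero_right]), zero_add] at h1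
  rw [Finset.sum_eq_zero (s := Ehat.filter (fun e => e.1 = i))
    (fun e he => by rw [hout e he, neg_zero, inner_zero_right]), zero_add] at h2
  have hstep : ∀ e ∈ Ehat.filter (fun e => e.2 = i),
      ⟪p2 e, -Gmap Dt Dh (Pi.single i (W2 i - W1 i)) e⟫ =
        -⟪p1 e, Gmap Dt Dh (Pi.single i (W2 i - W1 i)) e⟫
        - ρ e * ‖Gmap Dt Dh (Pi.single i (W2 i - W1 i)) e‖ ^ 2 := by
    intro e he
    obtain ⟨heE, rfl⟩ := Finset.mem_filter.1 he
    rw [hupd'.2 e heE, hr' e heE, Gmap_single_snd Dt Dh (hEloop e heE), inner_neg_right,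
      inner_add_left, real_inner_smul_left, real_inner_self_eq_norm_sq]
    ring
  rw [Finset.sum_congr rfl hstep, Finset.sum_sub_distrib, Finset.sum_neg_distrib] at h2
  have hnonneg : ∀ e ∈ Ehat.filter (fun e => e.2 = i),
      0 ≤ ρ e * ‖Gmap Dt Dh (Pi.single i (W2 i - W1 i)) e‖ ^ 2 := fun e he =>
    mul_nonneg (hρ e (Finset.mem_filter.1 he).1).le (sq_nonneg _)
  have hzero := (Finset.sum_eq_zero_iff_of_nonneg hnonneg).1
    (le_antisymm (by linarith) (Finset.sum_nonneg hnonneg))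
  have hin : ∀ e ∈ Ehat.filter (fun e => e.2 = i),
      Gmap Dt Dh (Pi.single i (W2 i - W1 i)) e = 0 := fun e he => by
    simpa [(hρ e (Finset.mem_filter.1 he).1).ne'] using hzero e he
  rw [Finset.sum_eq_zero (s := Ehat.filter (fun e => e.2 = i))
    (fun e he => by rw [hin e he, inner_zero_right]), Finset.sum_eq_zero hzero] at h2
  have hfle : f i (W2 i) ≤ f i (W1 i) := by linarith
  refine huniq _ _ ⟨(hupd'.1 i).1, fun z hz => le_trans ?_ ((hupd.1 i).2 z hz)⟩ (hupd.1 i)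
  unfold updObj
  refine add_le_add (add_le_add hfle ?_) ?_
  · refine (Finset.sum_congr rfl fun e he => ?_).le
    rw [Gmap_update_eq_add Dt Dh W0 i (W1 i), hout e he, add_zero]
  · refine (Finset.sum_congr rfl fun e he => ?_).le
    rw [Gmap_update_eq_add Dt Dh W1 i (W1 i), hin e he, add_zero]

/-- Splitting the coupling terms of the Lagrangian among the nodes. -/
lemma sum_inner_Gmap_single [Fintype ι] {Ehat : Finset (ι × ι)}
    (hEloop : ∀ e ∈ Ehat, e.1 ≠ e.2) (p : ι × ι → EuclideanSpace ℝ (Fin m)) (V : ∀ i, H i) :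
    ∑ i, ((∑ e ∈ Ehat.filter (fun e => e.1 = i), ⟪p e, Gmap Dt Dh (Pi.single i (V i)) e⟫)
        + ∑ e ∈ Ehat.filter (fun e => e.2 = i), ⟪p e, Gmap Dt Dh (Pi.single i (V i)) e⟫) =
      ∑ e ∈ Ehat, ⟪p e, Gmap Dt Dh V e⟫ := by
  simp only [Finset.sum_filter, Finset.sum_add_distrib]
  rw [Finset.sum_comm, Finset.sum_comm (s := Finset.univ), ← Finset.sum_add_distrib]
  refine Finset.sum_congr rfl fun e he => ?_
  simp only [Finset.sum_ite_eq, Finset.mem_univ, if_true]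
  rw [Gmap_single_fst Dt Dh (hEloop e he), Gmap_single_snd Dt Dh (hEloop e he), Gmap,
    inner_add_right]

end Coupling

/-- A finite acyclic relation is well founded when followed forwards. -/
lemma wellFounded_flip_transGen_of_acyclic {ι : Type*} [Finite ι] {r : ι → ι → Prop}
    (hr : ∀ v, ¬ Relation.TransGen r v v) :
    WellFounded (fun b a => Relation.TransGen r a b) :=
  haveI : IsTrans ι (fun b a => Relation.TransGen r a b) := ⟨fun _ _ _ h h' => h'.trans h⟩
  haveI : Std.Irrefl (fun b a => Relation.TransGen r a b) := ⟨hr⟩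
  Finite.wellFounded_of_trans_of_irrefl _

/-- along a scheduled-asynchronous trajectory satisfying the invariance
identity `r_e^{n+1} = D_ki(W_k^{n+1} − W_k^n)` for all `n` and all edges, under an acyclic
orientation, uniqueness of each subproblem minimizer, and uniqueness of the optimal
primal-dual pair, the residual vanishes after finitely many steps and the trajectory
reaches the optimal primal-dual pair. -/
theorem stmt5 {ι : Type*} [Fintype ι] [DecidableEq ι] {m : ℕ} {H : ι → Type*}
    [∀ i, NormedAddCommGroup (H i)] [∀ i, InnerProductSpace ℝ (H i)]
    [∀ i, FiniteDimensional ℝ (H i)]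
    (Ehat : Finset (ι × ι)) (hEloop : ∀ e ∈ Ehat, e.1 ≠ e.2)
    (hEor : ∀ e ∈ Ehat, (e.2, e.1) ∉ Ehat)
    -- the orientation is acyclic: no vertex reaches itself through directed edges
    (hacyc : ∀ v : ι, ¬ Relation.TransGen (fun a b => (a, b) ∈ Ehat) v v)
    (Dt : ∀ e : ι × ι, H e.1 →ₗ[ℝ] EuclideanSpace ℝ (Fin m))
    (Dh : ∀ e : ι × ι, H e.2 →ₗ[ℝ] EuclideanSpace ℝ (Fin m))
    (ρ : ι × ι → ℝ) (hρ : ∀ e ∈ Ehat, 0 < ρ e)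
    (𝒲 : ∀ i, Set (H i))
    (h𝒲 : ∀ i, (𝒲 i).Nonempty ∧ IsCompact (𝒲 i) ∧ Convex ℝ (𝒲 i))
    (f : ∀ i, H i → ℝ)
    (hf : ∀ i, ConvexOn ℝ Set.univ (f i)) (hfd : ∀ i, Differentiable ℝ (f i))
    -- (Wstar, pstar) is the unique optimal primal-dual pair
    (Wstar : ∀ i, H i) (pstar : ι × ι → EuclideanSpace ℝ (Fin m))
    (hWstar𝒲 : ∀ i, Wstar i ∈ 𝒲 i)
    (hfeas : ∀ e ∈ Ehat, Gmap Dt Dh Wstar e = 0)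
    (hlagr : ∀ W : ∀ i, H i, (∀ i, W i ∈ 𝒲 i) →
      (∑ i, f i (Wstar i)) + ∑ e ∈ Ehat, ⟪pstar e, Gmap Dt Dh Wstar e⟫ ≤
        (∑ i, f i (W i)) + ∑ e ∈ Ehat, ⟪pstar e, Gmap Dt Dh W e⟫)
    (huniqpd : ∀ (W : ∀ i, H i) (p : ι × ι → EuclideanSpace ℝ (Fin m)),
      (∀ i, W i ∈ 𝒲 i) → (∀ e ∈ Ehat, Gmap Dt Dh W e = 0) →
      (∀ W' : ∀ i, H i, (∀ i, W' i ∈ 𝒲 i) →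
        (∑ i, f i (W i)) + ∑ e ∈ Ehat, ⟪p e, Gmap Dt Dh W e⟫ ≤
          (∑ i, f i (W' i)) + ∑ e ∈ Ehat, ⟪p e, Gmap Dt Dh W' e⟫) →
      (∀ i, W i = Wstar i) ∧ (∀ e ∈ Ehat, p e = pstar e))
    -- the trajectory of the scheduled-asynchronous algorithm
    (W : ℕ → ∀ i, H i) (p : ℕ → ι × ι → EuclideanSpace ℝ (Fin m))
    (hW0 : ∀ i, W 0 i ∈ 𝒲 i)
    (hupd : ∀ n, IsScheduledUpdate Ehat Dt Dh ρ f 𝒲 (W n) (W (n+1)) (p n) (p (n+1)))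
    -- each update subproblem has a unique minimizer
    (huniqmin : ∀ n (i : ι) (x y : H i),
      (x ∈ 𝒲 i ∧ ∀ z ∈ 𝒲 i,
        updObj Ehat Dt Dh ρ f (p n) (W n) (W (n+1)) i x ≤
          updObj Ehat Dt Dh ρ f (p n) (W n) (W (n+1)) i z) →
      (y ∈ 𝒲 i ∧ ∀ z ∈ 𝒲 i,
        updObj Ehat Dt Dh ρ f (p n) (W n) (W (n+1)) i y ≤
          updObj Ehat Dt Dh ρ f (p n) (W n) (W (n+1)) i z) →
      x = y)
    -- the invariance identity r^{n+1} = D_ki(W_k^{n+1} - W_k^n)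
    (hr : ∀ n, ∀ e ∈ Ehat,
      Gmap Dt Dh (W (n+1)) e = Dh e (W (n+1) e.2 - W n e.2)) :
    ∃ n₀ : ℕ, (∀ e ∈ Ehat, Gmap Dt Dh (W (n₀+1)) e = 0) ∧
      W (n₀+1) = Wstar ∧ ∀ e ∈ Ehat, p (n₀+1) e = pstar e := by
  have hstat : ∀ i, ∃ N, ∀ n ≥ N, W (n + 1) i = W n i := by
    intro i
    induction i using (wellFounded_flip_transGen_of_acyclic hacyc).induction with
    | _ i ih =>
    have ih' : ∀ e : ι × ι, ∃ N, e ∈ Ehat → e.1 = i → ∀ n ≥ N, W (n + 1) e.2 = W n e.2 := by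
      intro e
      by_cases he : e ∈ Ehat ∧ e.1 = i
      · obtain ⟨he, rfl⟩ := he
        obtain ⟨N, hN⟩ := ih e.2 (Relation.TransGen.single he)
        exact ⟨N, fun _ _ => hN⟩
      · exact ⟨0, fun h h' => absurd ⟨h, h'⟩ he⟩
    choose N hN using ih'
    refine ⟨Ehat.sup N + 1, fun n hn => ?_⟩
    obtain ⟨n, rfl⟩ : ∃ k, n = k + 1 := ⟨n - 1, by omega⟩
    exact (hupd n).eq_of_heads_eq Dt Dh (hupd (n + 1)) hEloop hρ (hf i) (h𝒲 i).2.2 (hr n)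
      (hr (n + 1)) (huniqmin n i) fun e he hei =>
        hN e he hei n ((Finset.le_sup he).trans (by omega))
  choose N hN using hstat
  set n := Finset.univ.sup N
  have hW : ∀ i, W (n + 1) i = W n i := fun i => hN i n (Finset.le_sup (Finset.mem_univ i))
  have hres : ∀ e ∈ Ehat, Gmap Dt Dh (W (n + 1)) e = 0 := fun e he => by
    rw [hr n e he, hW, sub_self, map_zero]
  have hp : ∀ e ∈ Ehat, p (n + 1) e = p n e := fun e he => by
    rw [(hupd n).2 e he, hres e he, smul_zero, add_zero]
  have hopt := huniqpd (W (n + 1)) (p (n + 1)) (fun i => ((hupd n).1 i).1) hres fun Y hY => by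
    have hsum := Finset.sum_le_sum fun i (_ : i ∈ Finset.univ) =>
      (hupd n).first_order Dt Dh hEloop (hf i) (h𝒲 i).2.2 (hr n) (hY i)
    have hpout : ∀ i, ∀ e ∈ Ehat.filter (fun e => e.1 = i),
        ⟪p n e, Gmap Dt Dh (Pi.single i (Y i - W (n + 1) i)) e⟫ =
          ⟪p (n + 1) e, Gmap Dt Dh (Pi.single i (Y i - W (n + 1) i)) e⟫ := fun i e he => by
      rw [hp e (Finset.mem_filter.1 he).1]
    simp only [Finset.sum_congr rfl (hpout _)] at hsum
    rw [Finset.sum_add_distrib,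
      sum_inner_Gmap_single Dt Dh hEloop (p (n + 1)) (fun i => Y i - W (n + 1) i)] at hsum
    have hG : ∀ e, Gmap Dt Dh (fun i => Y i - W (n + 1) i) e =
        Gmap Dt Dh Y e - Gmap Dt Dh (W (n + 1)) e := fun e => by
      simp only [Gmap, map_sub]
      abel
    simp only [hG, inner_sub_right, Finset.sum_sub_distrib] at hsum
    linarith
  exact ⟨n, hres, funext hopt.1, hopt.2⟩
end

section
/- Let G be a finite simple undirected graph and let c₀ be a positive integer. The following are equivalent: (i) G admits an acyclic orientation in which every vertex has out-degree strictly less than c₀; (ii) every nonempty vertex-induced subgraph of G contains a vertex whose degree in that subgraph is strictly less than c₀. -/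
/-- If every nonempty vertex set induces a vertex of degree `< c`, then every finite vertex set has
an injective ranking for which each vertex has fewer than `c` neighbors of higher rank. -/
theorem SimpleGraph.exists_ranking_of_degenerate {V : Type*} (G : SimpleGraph V) (c : ℕ)
    (h : ∀ S : Set V, S.Nonempty → ∃ v ∈ S, {w | w ∈ S ∧ G.Adj v w}.ncard < c) (S : Finset V) :
    ∃ f : V → ℕ, Set.InjOn f S ∧
      ∀ v ∈ S, {w | w ∈ S ∧ G.Adj v w ∧ f v < f w}.ncard < c := by
  classical
  induction S using Finset.strongInduction with
  | H S ih =>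
    rcases S.eq_empty_or_nonempty with rfl | hS
    · exact ⟨fun _ => 0, by simp, by simp⟩
    obtain ⟨v, hvS, hv⟩ := h S hS
    obtain ⟨f, hf, hlt⟩ := ih (S.erase v) (Finset.erase_ssubset hvS)
    refine ⟨fun w => if w = v then 0 else f w + 1, fun a ha b hb hab => ?_, fun a ha => ?_⟩
    · by_cases hav : a = v <;> by_cases hbv : b = v <;>
        simp only [hav, hbv, if_true, if_false] at hab
      · rw [hav, hbv]
      · omega
      · omega
      · exact hf (Finset.mem_erase.2 ⟨hav, ha⟩) (Finset.mem_erase.2 ⟨hbv, hb⟩) (by omega)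
    · by_cases hav : a = v
      · subst hav
        refine (Set.ncard_le_ncard (fun w hw => ?_)
          (S.finite_toSet.subset fun w hw => hw.1)).trans_lt hv
        exact ⟨hw.1, hw.2.1⟩
      · refine (Set.ncard_le_ncard (fun w hw => ?_)
          ((S.erase v).finite_toSet.subset fun w hw => hw.1)).trans_lt
          (hlt a (Finset.mem_erase.2 ⟨hav, ha⟩))
        obtain ⟨hwS, hadj, hw⟩ := hw
        by_cases hwv : w = v
        · simp [hwv] at hw
        · simp only [hav, hwv, if_false] at hw
          exact ⟨Finset.mem_erase.2 ⟨hwv, hwS⟩, hadj, by omega⟩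


/-- Theorem 2 of the paper: a finite simple graph `G` admits an acyclic
orientation with all out-degrees `< c₀` if and only if every nonempty vertex-induced
subgraph has a vertex of induced degree `< c₀`. -/
theorem stmt7 {V : Type*} [Fintype V] (G : SimpleGraph V) (c₀ : ℕ) (hc₀ : 0 < c₀) :
    (∃ r : V → V → Prop,
       (∀ a b, r a b → ¬ r b a) ∧
       (∀ a b, G.Adj a b ↔ (r a b ∨ r b a)) ∧
       (∀ v, ¬ Relation.TransGen r v v) ∧
       (∀ v, {w | r v w}.ncard < c₀)) ↔
    (∀ S : Set V, S.Nonempty → ∃ v ∈ S, {w | w ∈ S ∧ G.Adj v w}.ncard < c₀) := by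
  constructor
  · rintro ⟨r, -, hadj, hacyc, hdeg⟩ S hS
    have : Std.Irrefl (Relation.TransGen r) := ⟨hacyc⟩
    obtain ⟨v, hvS, hv⟩ :=
      (Finite.wellFounded_of_trans_of_irrefl (Relation.TransGen r)).has_min S hS
    refine ⟨v, hvS, (Set.ncard_le_ncard (fun w hw => ?_) (Set.toFinite _)).trans_lt (hdeg v)⟩
    exact ((hadj v w).1 hw.2).resolve_right fun hwv => hv w hw.1 (.single hwv)
  · intro h
    obtain ⟨f, hf, hlt⟩ := G.exists_ranking_of_degenerate c₀ h Finset.univ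
    refine ⟨fun a b => G.Adj a b ∧ f a < f b, fun a b hab hba => hab.2.asymm hba.2,
      fun a b => ⟨fun hab => ?_, ?_⟩, fun v hv => ?_, fun v => by simpa using hlt v⟩
    · have hne : f a ≠ f b := fun heq => hab.ne (hf (by simp) (by simp) heq)
      exact hne.lt_or_gt.imp (⟨hab, ·⟩) (⟨hab.symm, ·⟩)
    · rintro (hab | hba)
      exacts [hab.1, hba.1.symm]
    · have hmono : ∀ {a b}, Relation.TransGen (fun a b => G.Adj a b ∧ f a < f b) a b →
          f a < f b := fun hab => by
        induction hab with
        | single hab => exact hab.2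
        | tail _ hbc ih => exact ih.trans hbc.2
      exact (hmono hv).false
end

section
/- Let G be a finite simple undirected graph with at least one vertex. Then the chromatic number of G satisfies χ(G) = 1 + min over all acyclic orientations ω of G of the maximum length (number of edges) of a directed path in the oriented graph G_ω. -/
theorem List.IsChain.nodup_of_acyclic {V : Type*} {r : V → V → Prop}
    (hr : ∀ v, ¬ Relation.TransGen r v v) {l : List V} (hl : l.IsChain r) : l.Nodup := by
  have h : l.IsChain (Relation.TransGen r) := hl.imp fun _ _ => Relation.TransGen.single
  refine (List.isChain_iff_pairwise.mp h).imp ?_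
  rintro a _ hab rfl
  exact hr a hab

/-- The set of lengths of directed paths of a relation. -/
def pathLengths {V : Type*} (r : V → V → Prop) : Set ℕ :=
  { n | ∃ l : List V, l.Nodup ∧ l.IsChain r ∧ l.length = n + 1 }

theorem bddAbove_pathLengths {V : Type*} [Fintype V] (r : V → V → Prop) :
    BddAbove (pathLengths r) := by
  refine ⟨Fintype.card V, ?_⟩
  rintro n ⟨l, hl, -, hn⟩
  have := hl.length_le_card
  omega

/-- **Gallai–Roy**: an acyclic orientation colors the graph by longest path lengths. -/
theorem SimpleGraph.colorable_of_acyclic_orientation {V : Type*} [Fintype V]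
    {G : SimpleGraph V} {r : V → V → Prop} (hG : ∀ a b, G.Adj a b → r a b ∨ r b a)
    (hr : ∀ v, ¬ Relation.TransGen r v v) : G.Colorable (1 + sSup (pathLengths r)) := by
  let T : V → Set ℕ := fun v => { n | ∃ l : List V, (v :: l).IsChain r ∧ l.length = n }
  have hT : ∀ v, T v ⊆ pathLengths r := by
    rintro v n ⟨l, hl, rfl⟩
    exact ⟨v :: l, hl.nodup_of_acyclic hr, hl, rfl⟩
  have hbdd : ∀ v, BddAbove (T v) := fun v => (bddAbove_pathLengths r).mono (hT v)
  have hmem : ∀ v, sSup (T v) ∈ T v := fun v =>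
    Nat.sSup_mem ⟨0, [], List.isChain_singleton v, rfl⟩ (hbdd v)
  have hlt : ∀ a b, r a b → sSup (T b) < sSup (T a) := by
    intro a b hab
    obtain ⟨l, hl, hlen⟩ := hmem b
    have : sSup (T b) + 1 ∈ T a :=
      ⟨b :: l, List.isChain_cons_cons.mpr ⟨hab, hl⟩, by simp [hlen]⟩
    exact le_csSup (hbdd a) this
  refine ⟨SimpleGraph.Coloring.mk (fun v => ⟨sSup (T v), ?_⟩) ?_⟩
  · have := le_csSup (bddAbove_pathLengths r) (hT v (hmem v))
    omega
  · intro a b hab heq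
    have heq' : sSup (T a) = sSup (T b) := congrArg Fin.val heq
    rcases hG a b hab with h | h
    · exact (hlt _ _ h).ne' heq'
    · exact (hlt _ _ h).ne heq'

/-- A proper coloring with `k + 1` colors gives an acyclic orientation, from smaller to larger
colors, whose paths have length at most `k`. -/
theorem SimpleGraph.Colorable.exists_acyclic_orientation {V : Type*}
    {G : SimpleGraph V} {k : ℕ} (hG : G.Colorable (k + 1)) :
    ∃ r : V → V → Prop, ((∀ a b, r a b → ¬ r b a) ∧
      (∀ a b, G.Adj a b ↔ (r a b ∨ r b a)) ∧ (∀ v, ¬ Relation.TransGen r v v)) ∧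
      sSup (pathLengths r) ≤ k := by
  obtain ⟨C⟩ := hG
  refine ⟨fun a b => G.Adj a b ∧ C a < C b, ⟨fun a b h h' => lt_asymm h.2 h'.2, ?_, ?_⟩, ?_⟩
  · refine fun a b => ⟨fun h => ?_, ?_⟩
    · exact (lt_or_gt_of_ne (C.valid h)).imp (⟨h, ·⟩) (⟨h.symm, ·⟩)
    · rintro (h | h)
      exacts [h.1, h.1.symm]
  · intro v hv
    have h : ∀ {b}, Relation.TransGen (fun a b => G.Adj a b ∧ C a < C b) v b → C v < C b := by
      intro b hb
      induction hb with
      | single h => exact h.2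
      | tail _ h ih => exact ih.trans h.2
    exact lt_irrefl _ (h hv)
  · refine csSup_le' ?_
    rintro n ⟨l, -, hl, hn⟩
    have hchain : (l.map C).IsChain (· < ·) :=
      (List.isChain_map C).mpr (hl.imp fun _ _ h => h.2)
    have hnodup : (l.map C).Nodup :=
      (List.isChain_iff_pairwise.mp hchain).imp fun h => h.ne
    have := hnodup.length_le_card
    simp only [List.length_map, Fintype.card_fin] at this
    omega

/-- Gallai–Roy type identity, Eq. (15) of the paper: for a finite
nonempty simple graph, the chromatic number equals one plus the minimum, over all
acyclic orientations, of the maximum length (number of edges) of a directed path. -/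
theorem stmt10 {V : Type*} [Fintype V] [Nonempty V] (G : SimpleGraph V) :
    G.chromaticNumber =
      ((1 + sInf { M : ℕ | ∃ r : V → V → Prop,
          ((∀ a b, r a b → ¬ r b a) ∧
           (∀ a b, G.Adj a b ↔ (r a b ∨ r b a)) ∧
           (∀ v, ¬ Relation.TransGen r v v)) ∧
          M = sSup { n : ℕ |
            ∃ l : List V, l.Nodup ∧ l.Chain' r ∧ l.length = n + 1 } } : ℕ) : ℕ∞) := by
  obtain ⟨k, hk⟩ : ∃ k : ℕ, G.chromaticNumber = k :=
    ⟨_, (ENat.natCast_toNat (SimpleGraph.chromaticNumber_ne_top_iff_exists.mpr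
      ⟨_, G.colorable_of_fintype⟩)).symm⟩
  have hcol : G.Colorable k := SimpleGraph.chromaticNumber_le_iff_colorable.mp hk.le
  obtain ⟨m, rfl⟩ : ∃ m, k = m + 1 := by
    refine Nat.exists_eq_succ_of_ne_zero ?_
    rintro rfl
    obtain ⟨C⟩ := hcol
    exact (C (Classical.arbitrary V)).elim0
  obtain ⟨r, hr, hle⟩ := hcol.exists_acyclic_orientation
  apply le_antisymm
  · refine SimpleGraph.chromaticNumber_le_iff_colorable.mpr ?_
    obtain ⟨r', hr', hM⟩ := Nat.sInf_mem (⟨_, r, hr, rfl⟩ : Set.Nonempty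
      { M : ℕ | ∃ r : V → V → Prop,
          ((∀ a b, r a b → ¬ r b a) ∧
           (∀ a b, G.Adj a b ↔ (r a b ∨ r b a)) ∧
           (∀ v, ¬ Relation.TransGen r v v)) ∧
          M = sSup (pathLengths r) })
    have := SimpleGraph.colorable_of_acyclic_orientation (fun a b => (hr'.2.1 a b).mp) hr'.2.2
    rw [← hM] at this
    exact this
  · rw [hk, Nat.cast_le, add_comm]
    refine Nat.succ_le_succ (le_trans (Nat.sInf_le ?_) hle)
    exact ⟨r, hr, rfl⟩
end
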